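/- Let S denote the set of smooth 2π-periodic functions ℝ → ℝ. There is no ℝ-linear map A : (ℝ → ℝ) → (ℝ → ℝ) that sends S into S, restricts to a bijection of S onto S, satisfies ∫₀^{2π} (Af)(x)·g(x) dx = ∫₀^{2π} f(x)·(Ag)(x) dx for all f, g ∈ S, and has the property that for every u ∈ S there exists w ∈ S with A w = 2·(Au)·u' + u·(Au)' and w − w'' = 3·(u − u'')·u' + u·(u − u'')'. In other words, the periodic Degasperis–Procesi equation (the b-equation with b = 3) cannot be realized as an Euler equation on Diff^∞(S¹) for any regular inertia operator. -/

import Mathlib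

/-- The set of smooth `2π`-periodic functions `ℝ → ℝ`, identified with `C^∞(S¹)`. -/
def SmoothPeriodic : Set (ℝ → ℝ) :=
  {f | ContDiff ℝ (⊤ : ℕ∞) f ∧ Function.Periodic f (2 * Real.pi)}

namespace SmoothPeriodic

variable {f g : ℝ → ℝ}

theorem differentiable (hf : f ∈ SmoothPeriodic) : Differentiable ℝ f :=
  hf.1.differentiable (by simp)

theorem deriv_mem (hf : f ∈ SmoothPeriodic) : deriv f ∈ SmoothPeriodic := by
  refine ⟨(contDiff_infty_iff_deriv.1 hf.1).2, fun x => ?_⟩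
  rw [← deriv_comp_add_const]
  exact congrArg (deriv · x) (funext hf.2)

theorem add_mem (hf : f ∈ SmoothPeriodic) (hg : g ∈ SmoothPeriodic) : f + g ∈ SmoothPeriodic :=
  ⟨hf.1.add hg.1, hf.2.add hg.2⟩

theorem sub_mem (hf : f ∈ SmoothPeriodic) (hg : g ∈ SmoothPeriodic) : f - g ∈ SmoothPeriodic :=
  ⟨hf.1.sub hg.1, hf.2.sub hg.2⟩

theorem smul_mem (c : ℝ) (hf : f ∈ SmoothPeriodic) : c • f ∈ SmoothPeriodic :=
  ⟨contDiff_const.smul hf.1, hf.2.smul c⟩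

theorem const_mem (c : ℝ) : (fun _ => c) ∈ SmoothPeriodic :=
  ⟨contDiff_const, fun _ => rfl⟩

/-- A periodic solution of `f' = k f` with `k ≠ 0` vanishes. -/
theorem eq_zero_of_deriv_eq_mul (hf : f ∈ SmoothPeriodic) {k : ℝ} (hk : k ≠ 0)
    (h : ∀ x, deriv f x = k * f x) (x : ℝ) : f x = 0 := by
  have hd : ∀ y, HasDerivAt (fun y => f y * Real.exp (-k * y)) 0 y := fun y => by
    have h1 := (differentiable hf y).hasDerivAt
    have h2 := ((hasDerivAt_id' y).const_mul (-k)).exp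
    refine (h1.mul h2).congr_deriv ?_
    rw [h]; ring
  have hc := is_const_of_deriv_eq_zero (fun y => (hd y).differentiableAt) (fun y => (hd y).deriv)
    (x + 2 * Real.pi) x
  simp only [hf.2 x] at hc
  by_contra hx
  have := Real.exp_injective (mul_left_cancel₀ hx hc)
  have : k * (2 * Real.pi) = 0 := by linarith
  simp [hk, Real.pi_ne_zero] at this

/-- The Helmholtz operator `1 - ∂ₓ²` is injective on smooth periodic functions. -/
theorem eq_zero_of_helmholtz_eq_zero (hf : f ∈ SmoothPeriodic)
    (h : ∀ x, f x - deriv (deriv f) x = 0) : f = 0 := by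
  have hd := differentiable hf
  have hd' := differentiable (deriv_mem hf)
  have hsum := eq_zero_of_deriv_eq_mul (add_mem (deriv_mem hf) hf) one_ne_zero fun x => by
    rw [deriv_add (hd' x) (hd x)]
    simp only [Pi.add_apply]
    linarith [h x]
  funext x
  refine eq_zero_of_deriv_eq_mul hf (k := -1) (by norm_num) (fun y => ?_) x
  have := hsum y
  simp only [Pi.add_apply] at this
  linarith

theorem eq_of_helmholtz_eq (hf : f ∈ SmoothPeriodic) (hg : g ∈ SmoothPeriodic)
    (h : ∀ x, f x - deriv (deriv f) x = g x - deriv (deriv g) x) : f = g := by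
  refine sub_eq_zero.1 (eq_zero_of_helmholtz_eq_zero (sub_mem hf hg) fun x => ?_)
  have h1 : deriv (f - g) = deriv f - deriv g :=
    funext fun y => deriv_sub (differentiable hf y) (differentiable hg y)
  rw [h1, deriv_sub (differentiable (deriv_mem hf) x) (differentiable (deriv_mem hg) x)]
  simp only [Pi.sub_apply]
  linarith [h x]

/-- A periodic solution of the rotation system `f' = -α g`, `g' = α f` vanishes if `α` is not
an integer. -/
theorem eq_zero_of_rotation (hf : f ∈ SmoothPeriodic) (hg : g ∈ SmoothPeriodic) {α : ℝ}
    (hα : ∀ m : ℤ, (m : ℝ) ≠ α) (h₁ : ∀ x, deriv f x = -(α * g x))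
    (h₂ : ∀ x, deriv g x = α * f x) : f = 0 ∧ g = 0 := by
  have hcos : ∀ y, HasDerivAt (fun y => Real.cos (α * y)) (-Real.sin (α * y) * α) y := fun y => by
    simpa using ((hasDerivAt_id' y).const_mul α).cos
  have hsin : ∀ y, HasDerivAt (fun y => Real.sin (α * y)) (Real.cos (α * y) * α) y := fun y => by
    simpa using ((hasDerivAt_id' y).const_mul α).sin
  have hf' := fun y => (differentiable hf y).hasDerivAt
  have hg' := fun y => (differentiable hg y).hasDerivAt
  have hH : ∀ y, HasDerivAt (fun y => f y * Real.cos (α * y) + g y * Real.sin (α * y)) 0 y :=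
    fun y => by
      refine (((hf' y).mul (hcos y)).add ((hg' y).mul (hsin y))).congr_deriv ?_
      rw [h₁, h₂]; ring
  have hK : ∀ y, HasDerivAt (fun y => g y * Real.cos (α * y) - f y * Real.sin (α * y)) 0 y :=
    fun y => by
      refine (((hg' y).mul (hcos y)).sub ((hf' y).mul (hsin y))).congr_deriv ?_
      rw [h₁, h₂]; ring
  have hHc := is_const_of_deriv_eq_zero (fun y => (hH y).differentiableAt) fun y => (hH y).deriv
  have hKc := is_const_of_deriv_eq_zero (fun y => (hK y).differentiableAt) fun y => (hK y).deriv
  have hne : Real.cos (α * (2 * Real.pi)) ≠ 1 := fun h => by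
    obtain ⟨m, hm⟩ := (Real.cos_eq_one_iff _).1 h
    exact hα m (mul_right_cancel₀ (by positivity) hm)
  have hH0 := hHc (2 * Real.pi) 0
  have hK0 := hKc (2 * Real.pi) 0
  have hpf : f (2 * Real.pi) = f 0 := by simpa using hf.2 0
  have hpg : g (2 * Real.pi) = g 0 := by simpa using hg.2 0
  simp only [hpf, hpg, mul_zero, Real.cos_zero, Real.sin_zero] at hH0 hK0
  have hcs := Real.sin_sq_add_cos_sq (α * (2 * Real.pi))
  set C := Real.cos (α * (2 * Real.pi))
  set S := Real.sin (α * (2 * Real.pi))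
  have hne' : 2 * (1 - C) ≠ 0 := mul_ne_zero two_ne_zero (sub_ne_zero.2 hne.symm)
  have hf0 : f 0 = 0 := by
    refine (mul_eq_zero.1 (?_ : 2 * (1 - C) * f 0 = 0)).resolve_left hne'
    linear_combination (C - 1) * hH0 - S * hK0 - f 0 * hcs
  have hg0 : g 0 = 0 := by
    refine (mul_eq_zero.1 (?_ : 2 * (1 - C) * g 0 = 0)).resolve_left hne'
    linear_combination (C - 1) * hK0 + S * hH0 - g 0 * hcs
  have hz : ∀ x, f x = 0 ∧ g x = 0 := fun x => by
    have e₁ := hHc x 0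
    have e₂ := hKc x 0
    simp only [hf0, hg0, zero_mul, add_zero, sub_zero] at e₁ e₂
    have := Real.sin_sq_add_cos_sq (α * x)
    constructor
    · linear_combination Real.cos (α * x) * e₁ - Real.sin (α * x) * e₂ - f x * this
    · linear_combination Real.sin (α * x) * e₁ + Real.cos (α * x) * e₂ - g x * this
  exact ⟨funext fun x => (hz x).1, funext fun x => (hz x).2⟩

end SmoothPeriodic

/-- The trigonometric function `a cos (k x) + b sin (k x)`. -/
noncomputable def trig (k a b : ℝ) : ℝ → ℝ :=
  fun x => a * Real.cos (k * x) + b * Real.sin (k * x)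

theorem deriv_trig (k a b : ℝ) : deriv (trig k a b) = trig k (k * b) (-(k * a)) := by
  funext x
  have hcos : HasDerivAt (fun y => Real.cos (k * y)) (-Real.sin (k * x) * k) x := by
    simpa using ((hasDerivAt_id' x).const_mul k).cos
  have hsin : HasDerivAt (fun y => Real.sin (k * y)) (Real.cos (k * x) * k) x := by
    simpa using ((hasDerivAt_id' x).const_mul k).sin
  refine ((hcos.const_mul a).add (hsin.const_mul b)).deriv.trans ?_
  simp only [trig]; ring

theorem trig_mem (n : ℕ) (a b : ℝ) : trig n a b ∈ SmoothPeriodic := by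
  refine ⟨by unfold trig; fun_prop, fun x => ?_⟩
  have h : (n : ℝ) * (x + 2 * Real.pi) = n * x + n * (2 * Real.pi) := by ring
  simp only [trig, h, Real.cos_add_nat_mul_two_pi, Real.sin_add_nat_mul_two_pi]

theorem trig_eq_smul (k r a b : ℝ) : trig k (r * a) (r * b) = r • trig k a b := by
  funext x
  simp only [trig, Pi.smul_apply, smul_eq_mul]; ring

/-- The Degasperis–Procesi equation is the Euler equation of the inertia operator `A`. -/
def IsDegasperisProcesiInertia (A : (ℝ → ℝ) →ₗ[ℝ] (ℝ → ℝ)) : Prop :=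
  ∀ u ∈ SmoothPeriodic, ∃ w ∈ SmoothPeriodic,
    (∀ x, A w x = 2 * A u x * deriv u x + u x * deriv (A u) x) ∧
    (∀ x, w x - deriv (deriv w) x =
      3 * (u x - deriv (deriv u) x) * deriv u x
        + u x * deriv (fun y => u y - deriv (deriv u) y) x)

namespace IsDegasperisProcesiInertia

open SmoothPeriodic

variable {A : (ℝ → ℝ) →ₗ[ℝ] (ℝ → ℝ)}

theorem map_eq (hA : IsDegasperisProcesiInertia A) {u w : ℝ → ℝ}
    (hu : u ∈ SmoothPeriodic) (hw : w ∈ SmoothPeriodic)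
    (h : ∀ x, w x - deriv (deriv w) x =
      3 * (u x - deriv (deriv u) x) * deriv u x
        + u x * deriv (fun y => u y - deriv (deriv u) y) x) (x : ℝ) :
    A w x = 2 * A u x * deriv u x + u x * deriv (A u) x := by
  obtain ⟨w', hw', hAw, hLw⟩ := hA u hu
  rw [eq_of_helmholtz_eq hw hw' fun y => (h y).trans (hLw y).symm, hAw]

theorem exists_map_one (hA : IsDegasperisProcesiInertia A)
    (hS : ∀ f ∈ SmoothPeriodic, A f ∈ SmoothPeriodic) :
    ∃ c : ℝ, ∀ x, A (fun _ => 1) x = c := by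
  have h := hA.map_eq (const_mem 1) (const_mem 0) (fun x => by simp)
  have h0 : A (fun _ => 0) = 0 := map_zero A
  refine ⟨A (fun _ => 1) 0, fun x => is_const_of_deriv_eq_zero
    (differentiable (hS _ (const_mem 1))) (fun y => ?_) x 0⟩
  simpa [h0] using (h y).symm

/-- The linearization of the Euler equation at the constant function `1`. -/
theorem map_linearized (hA : IsDegasperisProcesiInertia A) {c : ℝ}
    (hc : ∀ x, A (fun _ => 1) x = c) {v z : ℝ → ℝ}
    (hv : v ∈ SmoothPeriodic) (hz : z ∈ SmoothPeriodic)
    (h : ∀ x, z x - deriv (deriv z) x =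
      3 * deriv v x + deriv (fun y => v y - deriv (deriv v) y) x) (x : ℝ) :
    A z x = 2 * c * deriv v x + deriv (A v) x := by
  obtain ⟨w, hw, hAw, hLw⟩ := hA v hv
  have hd : deriv ((fun _ => 1) + v) = deriv v := by
    funext y
    exact deriv_const_add ..
  have hAd : deriv (A ((fun _ => 1) + v)) = deriv (A v) := by
    have : A ((fun _ => 1) + v) = fun y => c + A v y := by
      rw [map_add]
      funext y
      simp [hc]
    rw [this]
    funext y
    exact deriv_const_add ..
  have hL : deriv (fun y => ((fun _ => 1) + v : ℝ → ℝ) y - deriv (deriv ((fun _ => 1) + v)) y)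
      = deriv (fun y => v y - deriv (deriv v) y) := by
    rw [hd]
    simp only [Pi.add_apply, add_sub_assoc]
    funext y
    exact deriv_const_add ..
  have hzw : deriv (z + w) = deriv z + deriv w :=
    funext fun y => deriv_add (differentiable hz y) (differentiable hw y)
  have key := hA.map_eq (add_mem (const_mem 1) hv) (add_mem hz hw) (fun y => by
    rw [hL, hd, hzw, deriv_add (differentiable (deriv_mem hz) y) (differentiable (deriv_mem hw) y)]
    simp only [Pi.add_apply]
    linear_combination h y + hLw y) x
  rw [hAd, hd, map_add, map_add] at key
  simp only [Pi.add_apply, hc] at key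
  linear_combination key - hAw x

/-- Trigonometric functions are eigenfunctions of the inertia operator, away from resonance. -/
theorem map_trig (hA : IsDegasperisProcesiInertia A)
    (hS : ∀ f ∈ SmoothPeriodic, A f ∈ SmoothPeriodic) {c : ℝ}
    (hc : ∀ x, A (fun _ => 1) x = c) {n : ℕ}
    (hα : ∀ m : ℤ, (m : ℝ) ≠ n * (n ^ 2 + 4) / (n ^ 2 + 1)) :
    A (trig n 1 0) = (2 * c * (n ^ 2 + 1) / 3) • trig n 1 0 ∧
      A (trig n 0 1) = (2 * c * (n ^ 2 + 1) / 3) • trig n 0 1 := by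
  have hn1 : (n : ℝ) ^ 2 + 1 ≠ 0 := by positivity
  set α : ℝ := n * (n ^ 2 + 4) / (n ^ 2 + 1) with hαdef
  set β : ℝ := 2 * c * (n ^ 2 + 1) / 3 with hβdef
  have hαβ : α * β = n * β + 2 * c * n := by
    rw [hαdef, hβdef]; field_simp; ring
  have hαn : α * (n ^ 2 + 1) = n * (n ^ 2 + 4) := by
    rw [hαdef]; field_simp
  have hlin : ∀ a b x, A (trig n (α * b) (α * -a)) x
      = 2 * c * deriv (trig n a b) x + deriv (A (trig n a b)) x := fun a b => by
    refine hA.map_linearized hc (trig_mem n a b) (trig_mem n _ _) fun x => ?_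
    have hL : (fun y => trig n a b y - deriv (deriv (trig n a b)) y)
        = trig n ((n ^ 2 + 1) * a) ((n ^ 2 + 1) * b) := by
      funext y
      simp only [deriv_trig, trig]; ring
    rw [hL]
    simp only [deriv_trig, trig]
    linear_combination (b * Real.cos (n * x) - a * Real.sin (n * x)) * hαn
  have hF := hS _ (trig_mem n 1 0)
  have hG := hS _ (trig_mem n 0 1)
  have h₁ := hlin 1 0
  have h₂ := hlin 0 1
  have e₁ : trig n (α * 0) (α * -1) = (-α) • trig n 0 1 := by
    rw [← trig_eq_smul]; congr 1 <;> ring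
  have e₂ : trig n (α * 1) (α * -0) = α • trig n 1 0 := by
    rw [← trig_eq_smul]; congr 1; ring
  simp only [e₁, e₂, map_smul, Pi.smul_apply, smul_eq_mul, deriv_trig] at h₁ h₂
  have hd : ∀ {F : ℝ → ℝ}, F ∈ SmoothPeriodic → ∀ a b x,
      deriv (F - β • trig n a b) x = deriv F x - β * deriv (trig n a b) x := fun hF a b x => by
    have ht := differentiable (trig_mem n a b) x
    rw [deriv_sub (differentiable hF x) (ht.const_smul β), deriv_const_smul β ht, smul_eq_mul]
  have := eq_zero_of_rotation (sub_mem hF (smul_mem β (trig_mem n 1 0)))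
    (sub_mem hG (smul_mem β (trig_mem n 0 1))) hα
    (fun x => by
      have := h₁ x
      rw [hd hF, deriv_trig]
      simp only [Pi.sub_apply, Pi.smul_apply, smul_eq_mul]
      simp only [trig] at this ⊢
      linear_combination -this - Real.sin (n * x) * hαβ)
    (fun x => by
      have := h₂ x
      rw [hd hG, deriv_trig]
      simp only [Pi.sub_apply, Pi.smul_apply, smul_eq_mul]
      simp only [trig] at this ⊢
      linear_combination -this + Real.cos (n * x) * hαβ)
  exact ⟨sub_eq_zero.1 this.1, sub_eq_zero.1 this.2⟩

theorem map_one_eq_zero (hA : IsDegasperisProcesiInertia A)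
    (hS : ∀ f ∈ SmoothPeriodic, A f ∈ SmoothPeriodic) :
    A (fun _ => 1) = 0 := by
  obtain ⟨c, hc⟩ := hA.exists_map_one hS
  have h₁ := (hA.map_trig hS hc (n := 1) fun m hm => by
    have : (m : ℝ) * 2 = 5 := by rw [hm]; norm_num
    norm_cast at this
    omega).1
  have h₂ := (hA.map_trig hS hc (n := 2) fun m hm => by
    have : (m : ℝ) * 5 = 16 := by rw [hm]; norm_num
    norm_cast at this
    omega).2
  have hdouble : ∀ x, Real.sin (2 * x) = 2 * Real.sin x * Real.cos x := Real.sin_two_mul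
  have key := hA.map_eq (trig_mem 1 1 0) (smul_mem (-4 / 5) (trig_mem 2 0 1)) fun x => by
    have hL : (fun y => trig (1 : ℕ) 1 0 y - deriv (deriv (trig (1 : ℕ) 1 0)) y)
        = trig (1 : ℕ) 2 0 := by
      funext y
      simp only [deriv_trig, trig]; push_cast; ring
    rw [hL, ← trig_eq_smul]
    simp only [deriv_trig, trig]
    push_cast
    simp only [hdouble, one_mul]
    ring
  have h := key (Real.pi / 4)
  rw [map_smul, h₁, h₂, ← trig_eq_smul, ← trig_eq_smul, ← trig_eq_smul] at h
  simp only [deriv_trig, trig] at h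
  push_cast at h
  simp only [hdouble, one_mul, Real.sin_pi_div_four, Real.cos_pi_div_four] at h
  funext x
  rw [hc, Pi.zero_apply]
  ring_nf at h
  rw [Real.sq_sqrt (by norm_num)] at h
  linarith

end IsDegasperisProcesiInertia

/-- The periodic Degasperis–Procesi equation (the `b`-equation with `b = 3`) cannot be
realized as an Euler equation on `Diff^∞(S¹)` for any regular inertia operator. -/
theorem degasperis_procesi_not_euler :
    ¬ ∃ A : (ℝ → ℝ) → (ℝ → ℝ),
      IsLinearMap ℝ A ∧
      (∀ f ∈ SmoothPeriodic, A f ∈ SmoothPeriodic) ∧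
      Set.BijOn A SmoothPeriodic SmoothPeriodic ∧
      (∀ f ∈ SmoothPeriodic, ∀ g ∈ SmoothPeriodic,
        ∫ x in (0:ℝ)..(2 * Real.pi), A f x * g x =
          ∫ x in (0:ℝ)..(2 * Real.pi), f x * A g x) ∧
      (∀ u ∈ SmoothPeriodic, ∃ w ∈ SmoothPeriodic,
        (∀ x, A w x = 2 * A u x * deriv u x + u x * deriv (A u) x) ∧
        (∀ x, w x - deriv (deriv w) x =
          3 * (u x - deriv (deriv u) x) * deriv u x
            + u x * deriv (fun y => u y - deriv (deriv u) y) x)) := by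
  rintro ⟨A, hlin, hS, hbij, -, hE⟩
  have hA : IsDegasperisProcesiInertia (hlin.mk' A) := hE
  have h : A (fun _ => 1) = A (fun _ => 0) := (hA.map_one_eq_zero hS).trans hlin.map_zero.symm
  have := congrFun (hbij.injOn (SmoothPeriodic.const_mem 1) (SmoothPeriodic.const_mem 0) h) 0
  exact one_ne_zero this
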